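/- Fix reals a1 > 0, b1 > 0, a2 > 0, b2 ≥ 0 with Ω := a1/b1, an integer d ≥ 1, and T > 0. Let (μ_t)_{t ∈ [0,T]} be a family of Borel probability measures on ℝ, each supported in [0, Ω], and set m_k(t) := ∫ x^k dμ_t(x) for k = 0, 1, …, 2d. Assume that for every 1 ≤ k ≤ 2d−1 and every t ∈ [0,T], the function t ↦ m_k(t) is differentiable at t with derivative m_k'(t) = ∫ (L x^k)(x) dμ_t(x), where (L x^k)(x) = ((x+1)^k − x^k)·λ1(x) + ((x−1)^k − x^k)·λ2(x). Let F be the set of pairs of functions (X, U), X : [0,T] → ℝ^{2d} (coordinates indexed 0,…,2d−1) and U : [0,T] → ℝ, such that: (i) X_0(t) = 1 for all t and X_k(0) = m_k(0) for 0 ≤ k ≤ 2d−1; (ii) for every t ∈ [0,T] and every 1 ≤ k ≤ 2d−1, X_k is differentiable at t with X_k'(t) = Σ_{i=0}^{min(k+1, 2d−1)} c_{k,i}·X_i(t) + (if k = 2d−1 then c_{2d−1,2d}·U(t) else 0), where c_{k,i} denotes the coefficient of X^i in the polynomial p_k; (iii) for every t ∈ [0,T], the (d+1)×(d+1) matrix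 whose (i,j) entry (0 ≤ i,j ≤ d) is X_{i+j}(t) if i+j ≤ 2d−1 and U(t) if i+j = 2d is positive semidefinite; (iv) for every t ∈ [0,T], the d×d matrices with (i,j) entries (0 ≤ i,j ≤ d−1) given by X_{i+j+1}(t) and by Ω·X_{i+j}(t) − X_{i+j+1}(t), respectively, are both positive semidefinite. Then for every h ∈ ℝ^{2d}: sInf { Σ_{k=0}^{2d−1} h_k·X_k(T) : (X,U) ∈ F } ≤ Σ_{k=0}^{2d−1} h_k·m_k(T) ≤ sSup { Σ_{k=0}^{2d−1} h_k·X_k(T) : (X,U) ∈ F }. In particular, the moment trajectory (m_0,…,m_{2d−1}) together with U(t) := m_{2d}(t) is itself a member of F. -/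

import Mathlib

open MeasureTheory Polynomial

/-- The generator of the stochastic logistic model applied to the monomial `X^k`:
`p_k = ((X+1)^k − X^k)·(a1·X − b1·X²) + ((X−1)^k − X^k)·(a2·X + b2·X²)`. -/
noncomputable def logisticGenPoly (a1 b1 a2 b2 : ℝ) (k : ℕ) : Polynomial ℝ :=
  ((X + 1) ^ k - X ^ k) * (C a1 * X - C b1 * X ^ 2) +
    ((X - 1) ^ k - X ^ k) * (C a2 * X + C b2 * X ^ 2)

/-- The feasible set of the auxiliary linear optimal control problem with semidefinite
constraints for the stochastic logistic model on `[0, T]`.  A pair `P = (X, U)` with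
`X : ℝ → (Fin (2d) → ℝ)` (coordinates `0, …, 2d−1`) and `U : ℝ → ℝ` is feasible iff:
(i) `X_0(t) = 1` on `[0,T]` and `X(0)` matches the prescribed initial moments `m0`;
(ii) for all `t ∈ [0,T]` and `1 ≤ k ≤ 2d−1`, `X_k` is differentiable at `t` with
derivative `Σ_i c_{k,i}·X_i(t) + (if k = 2d−1 then c_{2d−1,2d}·U(t) else 0)`, where
`c_{k,i}` is the coefficient of `X^i` in `p_k` (the sum over `i = 0, …, 2d−1` equals the
sum up to `min(k+1, 2d−1)` since `p_k` has degree at most `k+1`);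
(iii) the `(d+1)×(d+1)` moment matrix, with entry `X_{i+j}(t)` if `i+j ≤ 2d−1` and
`U(t)` if `i+j = 2d`, is positive semidefinite on `[0,T]`;
(iv) the two `d×d` localizing matrices with entries `X_{i+j+1}(t)` and
`Ω·X_{i+j}(t) − X_{i+j+1}(t)` are positive semidefinite on `[0,T]`. -/
def logisticFiniteHorizonFeasible (a1 b1 a2 b2 Ω T : ℝ) (d : ℕ)
    (m0 : Fin (2 * d) → ℝ) : Set ((ℝ → Fin (2 * d) → ℝ) × (ℝ → ℝ)) :=
  {P |
    (∀ t ∈ Set.Icc (0 : ℝ) T, ∀ h0 : 0 < 2 * d, P.1 t ⟨0, h0⟩ = 1) ∧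
    (∀ k : Fin (2 * d), P.1 0 k = m0 k) ∧
    (∀ t ∈ Set.Icc (0 : ℝ) T, ∀ k : ℕ, 1 ≤ k → k ≤ 2 * d - 1 → ∀ hk : k < 2 * d,
      HasDerivAt (fun s => P.1 s ⟨k, hk⟩)
        ((∑ i : Fin (2 * d), (logisticGenPoly a1 b1 a2 b2 k).coeff (i : ℕ) * P.1 t i) +
          (if k = 2 * d - 1 then
            (logisticGenPoly a1 b1 a2 b2 k).coeff (2 * d) * P.2 t else 0)) t) ∧
    (∀ t ∈ Set.Icc (0 : ℝ) T,
      Matrix.PosSemidef (Matrix.of fun i j : Fin (d + 1) =>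
        if h : (i : ℕ) + (j : ℕ) < 2 * d then P.1 t ⟨(i : ℕ) + (j : ℕ), h⟩
        else P.2 t)) ∧
    (∀ t ∈ Set.Icc (0 : ℝ) T,
      Matrix.PosSemidef (Matrix.of fun i j : Fin d =>
        P.1 t ⟨(i : ℕ) + (j : ℕ) + 1, by have := i.isLt; have := j.isLt; omega⟩) ∧
      Matrix.PosSemidef (Matrix.of fun i j : Fin d =>
        Ω * P.1 t ⟨(i : ℕ) + (j : ℕ), by have := i.isLt; have := j.isLt; omega⟩ -
          P.1 t ⟨(i : ℕ) + (j : ℕ) + 1, by have := i.isLt; have := j.isLt; omega⟩))}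

lemma aux_natDegree (c : ℝ) (k : ℕ) (hk : 1 ≤ k) :
    ((X + C c : ℝ[X]) ^ k - X ^ k).natDegree ≤ k - 1 := by
  rw [natDegree_le_iff_coeff_eq_zero]
  intro N hN
  rw [coeff_sub, coeff_X_add_C_pow, coeff_X_pow]
  rcases eq_or_ne N k with h | h
  · subst h; simp
  · rw [Nat.choose_eq_zero_of_lt (by omega)]; simp [h]

lemma aux_gen_natDegree (a1 b1 a2 b2 : ℝ) (k : ℕ) (hk : 1 ≤ k) :
    (logisticGenPoly a1 b1 a2 b2 k).natDegree ≤ k + 1 := by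
  unfold logisticGenPoly
  have h1 := aux_natDegree 1 k hk
  have h2 := aux_natDegree (-1) k hk
  have e : (X + C (-1) : ℝ[X]) = X - 1 := by simp [sub_eq_add_neg]
  rw [e] at h2
  rw [C_1] at h1
  have h3 : (C a1 * X - C b1 * X ^ 2 : ℝ[X]).natDegree ≤ 2 := by compute_degree
  have h4 : (C a2 * X + C b2 * X ^ 2 : ℝ[X]).natDegree ≤ 2 := by compute_degree
  refine natDegree_add_le_of_degree_le ?_ ?_
  · exact natDegree_mul_le.trans (by omega)
  · exact natDegree_mul_le.trans (by omega)

lemma aux_integrable (ν : Measure ℝ) [IsProbabilityMeasure ν] (Ω : ℝ)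
    (h : ∀ᵐ x ∂ν, x ∈ Set.Icc (0 : ℝ) Ω) (f : ℝ → ℝ) (hf : Continuous f) : Integrable f ν := by
  obtain ⟨B, hB⟩ := isCompact_Icc.exists_bound_of_continuousOn (s := Set.Icc (0 : ℝ) Ω)
    hf.continuousOn
  exact Integrable.of_bound hf.aestronglyMeasurable B (h.mono fun x hx => hB x hx)

lemma aux_psd (ν : Measure ℝ) [IsProbabilityMeasure ν] (Ω : ℝ)
    (h : ∀ᵐ x ∂ν, x ∈ Set.Icc (0 : ℝ) Ω) (w : ℝ → ℝ) (hw : Continuous w)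
    (hw0 : ∀ x ∈ Set.Icc (0 : ℝ) Ω, 0 ≤ w x) (n : ℕ) (M : Matrix (Fin n) (Fin n) ℝ)
    (hM : ∀ i j, M i j = ∫ x, w x * x ^ ((i : ℕ) + (j : ℕ)) ∂ν) : M.PosSemidef := by
  refine Matrix.PosSemidef.of_dotProduct_mulVec_nonneg ?_ ?_
  · ext i j
    simp [hM, add_comm]
  · intro c
    have key : star c ⬝ᵥ (M.mulVec c) =
        ∫ x, w x * (∑ i : Fin n, c i * x ^ (i : ℕ)) ^ 2 ∂ν := by
      have e : ∀ x : ℝ, w x * (∑ i : Fin n, c i * x ^ (i : ℕ)) ^ 2 =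
          ∑ i : Fin n, ∑ j : Fin n, (c i * c j) * (w x * x ^ ((i : ℕ) + (j : ℕ))) := by
        intro x
        rw [sq, Finset.sum_mul_sum, Finset.mul_sum]
        refine Finset.sum_congr rfl fun i _ => ?_
        rw [Finset.mul_sum]
        refine Finset.sum_congr rfl fun j _ => ?_
        ring
      simp_rw [e]
      rw [integral_finsetSum _ (fun i _ => aux_integrable ν Ω h _ (by fun_prop))]
      simp only [dotProduct, Matrix.mulVec, Pi.star_apply, star_trivial]
      refine Finset.sum_congr rfl fun i _ => ?_
      rw [integral_finsetSum _ (fun i _ => aux_integrable ν Ω h _ (by fun_prop)), Finset.mul_sum]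
      refine Finset.sum_congr rfl fun j _ => ?_
      rw [integral_const_mul, hM]
      ring
    rw [key]
    exact integral_nonneg_of_ae (h.mono fun x hx => mul_nonneg (hw0 x hx) (sq_nonneg _))

lemma aux_two {n : ℕ} {M : Matrix (Fin n) (Fin n) ℝ} (hM : M.PosSemidef) (i j : Fin n) (a b : ℝ) :
    0 ≤ a ^ 2 * M i i + a * b * M i j + a * b * M j i + b ^ 2 * M j j := by
  have := (hM.submatrix ![i, j]).dotProduct_mulVec_nonneg ![a, b]
  simp [dotProduct, Matrix.mulVec, Fin.sum_univ_two] at this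
  linarith

lemma aux_bound (a1 b1 a2 b2 Ω T : ℝ) (hΩ : 0 < Ω) (hT : 0 < T) (d : ℕ) (m0 : Fin (2 * d) → ℝ)
    (P : (ℝ → Fin (2 * d) → ℝ) × (ℝ → ℝ))
    (hP : P ∈ logisticFiniteHorizonFeasible a1 b1 a2 b2 Ω T d m0) (k : ℕ) (hk : k < 2 * d) :
    0 ≤ P.1 T ⟨k, hk⟩ ∧ P.1 T ⟨k, hk⟩ ≤ Ω ^ k := by
  obtain ⟨h0, -, -, hM, hL⟩ := hP
  have hTm : T ∈ Set.Icc (0 : ℝ) T := ⟨hT.le, le_rfl⟩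
  specialize h0 T hTm
  specialize hM T hTm
  obtain ⟨hL1, hL2⟩ := hL T hTm
  have nonneg : ∀ k (hk : k < 2 * d), 0 ≤ P.1 T ⟨k, hk⟩ := by
    intro k hk
    rcases Nat.even_or_odd' k with ⟨i, rfl | rfl⟩
    · have := hM.diag_nonneg (i := ⟨i, by omega⟩)
      simp only [Matrix.of_apply, ← two_mul, hk, dite_true] at this
      exact this
    · have := hL1.diag_nonneg (i := ⟨i, by omega⟩)
      simp only [Matrix.of_apply, ← two_mul] at this
      exact this
  have step0 : ∀ i (hi : 2 * i + 1 < 2 * d),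
      P.1 T ⟨2 * i + 1, hi⟩ ≤ Ω * P.1 T ⟨2 * i, by omega⟩ := by
    intro i hi
    have := hL2.diag_nonneg (i := ⟨i, by omega⟩)
    simp only [Matrix.of_apply, ← two_mul] at this
    linarith
  have step : ∀ k (hk : k + 1 < 2 * d),
      P.1 T ⟨k + 1, hk⟩ ≤ Ω * P.1 T ⟨k, by omega⟩ := by
    intro k hk
    rcases Nat.even_or_odd' k with ⟨i, rfl | rfl⟩
    · exact step0 i hk
    · have h1 := aux_two hL1 ⟨i, by omega⟩ ⟨i + 1, by omega⟩ Ω (-1)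
      have h2 := step0 (i + 1) (by omega)
      simp only [Matrix.of_apply] at h1
      have e1 : i + i + 1 = 2 * i + 1 := by omega
      have e2 : i + (i + 1) + 1 = 2 * i + 1 + 1 := by omega
      have e3 : i + 1 + i + 1 = 2 * i + 1 + 1 := by omega
      have e4 : i + 1 + (i + 1) + 1 = 2 * (i + 1) + 1 := by omega
      have e5 : 2 * (i + 1) = 2 * i + 1 + 1 := by omega
      simp only [e1, e2, e3, e4] at h1
      have h3 : P.1 T ⟨2 * (i + 1), by omega⟩ = P.1 T ⟨2 * i + 1 + 1, hk⟩ := by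
        congr 1
      rw [h3] at h2
      refine le_of_mul_le_mul_left ?_ hΩ
      nlinarith
  refine ⟨nonneg k hk, ?_⟩
  induction k with
  | zero => rw [h0 hk]; simp
  | succ n ih =>
    refine (step n hk).trans ?_
    rw [pow_succ']
    exact mul_le_mul_of_nonneg_left (ih (by omega) step0 step) hΩ.le

/-- Finite-horizon moment bounds for the stochastic logistic model (Theorem 1 of the
paper instantiated to the logistic model): if `(μ_t)_{t∈[0,T]}` are probability measures
supported in `[0, Ω]` (`Ω = a1/b1`) whose moments satisfy the master-equation moment
dynamics, then the moment trajectory `(m_0, …, m_{2d−1})` together with `U(t) = m_{2d}(t)`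
is feasible for the auxiliary linear optimal control problem, and consequently every
linear functional of the terminal moments is bounded between the infimum and supremum of
that functional over the feasible set. -/
theorem logistic_finite_horizon_moment_bounds
    (a1 b1 a2 b2 : ℝ) (ha1 : 0 < a1) (hb1 : 0 < b1) (ha2 : 0 < a2) (hb2 : 0 ≤ b2)
    (d : ℕ) (hd : 1 ≤ d) (T : ℝ) (hT : 0 < T)
    (μ : ℝ → Measure ℝ)
    (hprob : ∀ t ∈ Set.Icc (0 : ℝ) T, IsProbabilityMeasure (μ t))
    (hsupp : ∀ t ∈ Set.Icc (0 : ℝ) T, ∀ᵐ x ∂(μ t), x ∈ Set.Icc (0 : ℝ) (a1 / b1))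
    (hderiv : ∀ k : ℕ, 1 ≤ k → k ≤ 2 * d - 1 → ∀ t ∈ Set.Icc (0 : ℝ) T,
      HasDerivAt (fun s => ∫ x, x ^ k ∂(μ s))
        (∫ x, (((x + 1) ^ k - x ^ k) * (a1 * x - b1 * x ^ 2) +
               ((x - 1) ^ k - x ^ k) * (a2 * x + b2 * x ^ 2)) ∂(μ t)) t) :
    ((fun t (k : Fin (2 * d)) => ∫ x, x ^ (k : ℕ) ∂(μ t)),
        (fun t => ∫ x, x ^ (2 * d) ∂(μ t))) ∈
      logisticFiniteHorizonFeasible a1 b1 a2 b2 (a1 / b1) T d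
        (fun k : Fin (2 * d) => ∫ x, x ^ (k : ℕ) ∂(μ 0)) ∧
    ∀ h : Fin (2 * d) → ℝ,
      sInf ((fun P : (ℝ → Fin (2 * d) → ℝ) × (ℝ → ℝ) =>
            ∑ k : Fin (2 * d), h k * P.1 T k) ''
          logisticFiniteHorizonFeasible a1 b1 a2 b2 (a1 / b1) T d
            (fun k : Fin (2 * d) => ∫ x, x ^ (k : ℕ) ∂(μ 0))) ≤
        ∑ k : Fin (2 * d), h k * ∫ x, x ^ (k : ℕ) ∂(μ T) ∧
      ∑ k : Fin (2 * d), h k * ∫ x, x ^ (k : ℕ) ∂(μ T) ≤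
        sSup ((fun P : (ℝ → Fin (2 * d) → ℝ) × (ℝ → ℝ) =>
            ∑ k : Fin (2 * d), h k * P.1 T k) ''
          logisticFiniteHorizonFeasible a1 b1 a2 b2 (a1 / b1) T d
            (fun k : Fin (2 * d) => ∫ x, x ^ (k : ℕ) ∂(μ 0))) := by
  have hΩ : 0 < a1 / b1 := div_pos ha1 hb1
  have hmem : ((fun t (k : Fin (2 * d)) => ∫ x, x ^ (k : ℕ) ∂(μ t)),
        (fun t => ∫ x, x ^ (2 * d) ∂(μ t))) ∈
      logisticFiniteHorizonFeasible a1 b1 a2 b2 (a1 / b1) T d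
        (fun k : Fin (2 * d) => ∫ x, x ^ (k : ℕ) ∂(μ 0)) := by
    refine ⟨?_, ?_, ?_, ?_, ?_⟩
    · intro t ht h0
      have := hprob t ht
      simp
    · intro k
      rfl
    · intro t ht k hk1 hk2 hk
      have := hprob t ht
      have hint := aux_integrable (μ t) _ (hsupp t ht)
      have hdeg := aux_gen_natDegree a1 b1 a2 b2 k hk1
      convert hderiv k hk1 hk2 t ht using 1
      have e : ∀ x : ℝ, ((x + 1) ^ k - x ^ k) * (a1 * x - b1 * x ^ 2) +
               ((x - 1) ^ k - x ^ k) * (a2 * x + b2 * x ^ 2) =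
          (∑ i : Fin (2 * d), (logisticGenPoly a1 b1 a2 b2 k).coeff (i : ℕ) * x ^ (i : ℕ)) +
            (logisticGenPoly a1 b1 a2 b2 k).coeff (2 * d) * x ^ (2 * d) := by
        intro x
        have h1 := eval_eq_sum_range' (p := logisticGenPoly a1 b1 a2 b2 k) (n := 2 * d + 1)
          (by omega) x
        rw [Finset.sum_range_succ, Finset.sum_range] at h1
        rw [← h1]
        simp [logisticGenPoly]
      simp_rw [e]
      rw [integral_add (hint _ (by fun_prop)) (hint _ (by fun_prop)),
        integral_finsetSum _ (fun i _ => hint _ (by fun_prop))]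
      simp_rw [integral_const_mul]
      congr 1
      split_ifs with hc
      · rfl
      · rw [coeff_eq_zero_of_natDegree_lt (by omega)]; simp
    · intro t ht
      have := hprob t ht
      refine aux_psd (μ t) _ (hsupp t ht) (fun _ => 1) (by fun_prop) (fun _ _ => zero_le_one) _ _ ?_
      intro i j
      simp only [Matrix.of_apply, one_mul]
      split_ifs with hij
      · rfl
      · have : (i : ℕ) + j = 2 * d := by omega
        rw [this]
    · intro t ht
      have := hprob t ht
      have hint := aux_integrable (μ t) _ (hsupp t ht)
      constructor
      · refine aux_psd (μ t) _ (hsupp t ht) (fun x => x) (by fun_prop) (fun _ hx => hx.1) _ _ ?_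
        intro i j
        simp only [Matrix.of_apply, pow_succ']
      · refine aux_psd (μ t) _ (hsupp t ht) (fun x => a1 / b1 - x) (by fun_prop)
          (fun _ hx => sub_nonneg.2 hx.2) _ _ ?_
        intro i j
        simp only [Matrix.of_apply, pow_succ', sub_mul]
        rw [integral_sub (hint _ (by fun_prop)) (hint _ (by fun_prop)), integral_const_mul]
  refine ⟨hmem, fun h => ?_⟩
  have hb : ∀ P ∈ logisticFiniteHorizonFeasible a1 b1 a2 b2 (a1 / b1) T d
        (fun k : Fin (2 * d) => ∫ x, x ^ (k : ℕ) ∂(μ 0)),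
      |∑ k : Fin (2 * d), h k * P.1 T k| ≤ ∑ k : Fin (2 * d), |h k| * (a1 / b1) ^ (k : ℕ) := by
    intro P hP
    refine (Finset.abs_sum_le_sum_abs _ _).trans (Finset.sum_le_sum fun k _ => ?_)
    obtain ⟨h1, h2⟩ := aux_bound _ _ _ _ _ _ hΩ hT d _ P hP k.1 k.2
    rw [abs_mul]
    refine mul_le_mul_of_nonneg_left ?_ (abs_nonneg _)
    rw [abs_of_nonneg h1]
    exact h2
  constructor
  · refine csInf_le ⟨-∑ k : Fin (2 * d), |h k| * (a1 / b1) ^ (k : ℕ), ?_⟩ ⟨_, hmem, rfl⟩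
    rintro _ ⟨P, hP, rfl⟩
    exact (abs_le.1 (hb P hP)).1
  · refine le_csSup ⟨∑ k : Fin (2 * d), |h k| * (a1 / b1) ^ (k : ℕ), ?_⟩ ⟨_, hmem, rfl⟩
    rintro _ ⟨P, hP, rfl⟩
    exact (abs_le.1 (hb P hP)).2
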